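/- Assume that no matrix in A = {A_1,…,A_m} is Barabanov. Then for every N ∈ ℕ_*, the set of sample vectors ω̄_N = (δ_1,…,δ_N) ∈ Δ^N that are degenerate for the sampled problem P_jsr — i.e., for which there exist two distinct subsets I ⊆ {1,…,N} such that {δ_i}_{i∈I} is an essential set for P_jsr(ω_N) — has ℙ^N-measure zero; equivalently, ω̄_N is non-degenerate with probability one. -/

import Mathlib

open MeasureTheory Matrix Metric
open scoped ENNReal

/-- A real matrix `A` is *Barabanov* if there exist a symmetric positive
definite matrix `P` and `γ ≥ 0` such that `AᵀPA = γ²P`. -/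
def IsBarabanov {n : ℕ} (A : Matrix (Fin n) (Fin n) ℝ) : Prop :=
  ∃ P : Matrix (Fin n) (Fin n) ℝ, P.IsSymm ∧ P.PosDef ∧
    ∃ γ : ℝ, 0 ≤ γ ∧ Aᵀ * P * A = γ ^ 2 • P

/-- The sample space `Δ = 𝒜 × S^{n-1}`, a sample being a pair (index of a
matrix in `𝒜`, point of the unit sphere of `ℝ^n`). -/
abbrev JsrSample (n m : ℕ) :=
  Fin m × ↥(sphere (0 : EuclideanSpace ℝ (Fin n)) 1)

/-- The uniform probability distribution `ℙ` on `Δ = 𝒜 × S^{n-1}`: product of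
the uniform distribution on the finite set `𝒜` and the normalized surface
measure on the sphere `S^{n-1}`. -/
noncomputable def jsrUniform (n m : ℕ) : Measure (JsrSample n m) :=
  ((m : ℝ≥0∞)⁻¹ • Measure.count).prod
    (((volume : Measure (EuclideanSpace ℝ (Fin n))).toSphere Set.univ)⁻¹ •
      (volume : Measure (EuclideanSpace ℝ (Fin n))).toSphere)

/-- The underlying vector in `ℝ^n` of a sample point. -/
def samplePoint {n m : ℕ} (δ : JsrSample n m) : Fin n → ℝ :=
  fun i => (δ.2 : EuclideanSpace ℝ (Fin n)) i

/-- Frobenius norm of a real matrix. -/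
noncomputable def frobNorm {n : ℕ} (P : Matrix (Fin n) (Fin n) ℝ) : ℝ :=
  Real.sqrt (∑ i, ∑ j, (P i j) ^ 2)

/-- Quadratic form `xᵀPx`. -/
def quadForm {n : ℕ} (P : Matrix (Fin n) (Fin n) ℝ) (x : Fin n → ℝ) : ℝ :=
  ∑ i, ∑ j, x i * P i j * x j

/-- Feasible points of the sampled problem `P_jsr(S)`: `γ ≥ 0`, `P` symmetric
with `P ⪰ I` and `‖P‖_F ≤ C`, and `(Ax)ᵀP(Ax) ≤ γ² xᵀPx` for all `(A,x) ∈ S`. -/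
def JsrFeasible {n m : ℕ} (𝒜 : Fin m → Matrix (Fin n) (Fin n) ℝ) (C : ℝ)
    (S : Set (JsrSample n m)) (γ : ℝ) (P : Matrix (Fin n) (Fin n) ℝ) : Prop :=
  0 ≤ γ ∧ P.IsSymm ∧ (P - 1).PosSemidef ∧ frobNorm P ≤ C ∧
    ∀ δ ∈ S, quadForm P ((𝒜 δ.1).mulVec (samplePoint δ)) ≤
      γ ^ 2 * quadForm P (samplePoint δ)

/-- Attainable values `(γ, ‖P‖_F²)`, in lexicographic order, of the sampled
problem `P_jsr(S)`. `Cost_jsr(S)` is the least element of this set. -/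
def JsrValues {n m : ℕ} (𝒜 : Fin m → Matrix (Fin n) (Fin n) ℝ) (C : ℝ)
    (S : Set (JsrSample n m)) : Set (ℝ ×ₗ ℝ) :=
  {p | ∃ γ P, JsrFeasible 𝒜 C S γ P ∧ p = toLex (γ, (frobNorm P) ^ 2)}

/-- `β` is an essential set for the problem with constraint set `S`:
a finite subset of `S` of minimal cardinality with the same optimal cost. -/
def IsEssentialSet {Δ : Type*} (Cost : Set Δ → ℝ ×ₗ ℝ) (S β : Set Δ) : Prop :=
  β ⊆ S ∧ β.Finite ∧ Cost β = Cost S ∧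
    ∀ β' : Set Δ, β' ⊆ S → β'.Finite → Cost β' = Cost S → β.ncard ≤ β'.ncard


/-- Squared Frobenius norm. -/
def frobSq {n : ℕ} (P : Matrix (Fin n) (Fin n) ℝ) : ℝ := ∑ i, ∑ j, (P i j) ^ 2

lemma frobSq_nonneg {n : ℕ} (P : Matrix (Fin n) (Fin n) ℝ) : 0 ≤ frobSq P := by
  unfold frobSq; positivity

lemma frobNorm_sq {n : ℕ} (P : Matrix (Fin n) (Fin n) ℝ) : frobNorm P ^ 2 = frobSq P :=
  Real.sq_sqrt (frobSq_nonneg P)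

lemma frobNorm_le_iff {n : ℕ} {C : ℝ} (hC : 0 ≤ C) (P : Matrix (Fin n) (Fin n) ℝ) :
    frobNorm P ≤ C ↔ frobSq P ≤ C ^ 2 :=
  Real.sqrt_le_left hC

lemma quadForm_comb {n : ℕ} (P Q : Matrix (Fin n) (Fin n) ℝ) (a b : ℝ) (x : Fin n → ℝ) :
    quadForm (a • P + b • Q) x = a * quadForm P x + b * quadForm Q x := by
  unfold quadForm
  simp only [Finset.mul_sum, ← Finset.sum_add_distrib, Matrix.add_apply, Matrix.smul_apply,
    smul_eq_mul]
  refine Finset.sum_congr rfl fun i _ => Finset.sum_congr rfl fun j _ => ?_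
  ring

lemma frobSq_comb {n : ℕ} (P Q : Matrix (Fin n) (Fin n) ℝ) (t : ℝ) :
    frobSq ((1 - t) • P + t • Q) =
      (1 - t) * frobSq P + t * frobSq Q - t * (1 - t) * frobSq (P - Q) := by
  unfold frobSq
  simp only [Finset.mul_sum, ← Finset.sum_add_distrib, ← Finset.sum_sub_distrib,
    Matrix.add_apply, Matrix.smul_apply, Matrix.sub_apply, smul_eq_mul]
  refine Finset.sum_congr rfl fun i _ => Finset.sum_congr rfl fun j _ => ?_
  ring

lemma eq_of_frobSq_sub_nonpos {n : ℕ} {P Q : Matrix (Fin n) (Fin n) ℝ}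
    (h : frobSq (P - Q) ≤ 0) : P = Q := by
  have h0 : frobSq (P - Q) = 0 := le_antisymm h (frobSq_nonneg _)
  unfold frobSq at h0
  ext i j
  rw [Finset.sum_eq_zero_iff_of_nonneg (fun i _ => by positivity)] at h0
  have h1 := h0 i (Finset.mem_univ _)
  rw [Finset.sum_eq_zero_iff_of_nonneg (fun i _ => by positivity)] at h1
  have h2 := h1 j (Finset.mem_univ _)
  rw [Matrix.sub_apply, sq_eq_zero_iff] at h2
  linarith

lemma quadForm_eq_dot {n : ℕ} (P : Matrix (Fin n) (Fin n) ℝ) (x : Fin n → ℝ) :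
    quadForm P x = x ⬝ᵥ (P *ᵥ x) := by
  simp only [quadForm, dotProduct, mulVec, Finset.mul_sum, mul_assoc]

lemma psd_iff {n : ℕ} {P : Matrix (Fin n) (Fin n) ℝ} (hP : P.IsSymm) :
    (P - 1).PosSemidef ↔ ∀ x : Fin n → ℝ, x ⬝ᵥ x ≤ quadForm P x := by
  rw [posSemidef_iff_dotProduct_mulVec]
  have h1 : (P - 1).IsHermitian := by
    have : P.IsHermitian := by
      rw [Matrix.IsHermitian, Matrix.conjTranspose_eq_transpose_of_trivial]; exact hP
    exact this.sub Matrix.isHermitian_one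
  simp only [h1, true_and, star_trivial, sub_mulVec, one_mulVec, dotProduct_sub, sub_nonneg,
    quadForm_eq_dot]

lemma feas_iff {n m : ℕ} {𝒜 : Fin m → Matrix (Fin n) (Fin n) ℝ} {C : ℝ} (hC : 0 ≤ C)
    {S : Set (JsrSample n m)} {γ : ℝ} {P : Matrix (Fin n) (Fin n) ℝ} :
    JsrFeasible 𝒜 C S γ P ↔
    0 ≤ γ ∧ P.IsSymm ∧ (∀ x : Fin n → ℝ, x ⬝ᵥ x ≤ quadForm P x) ∧ frobSq P ≤ C ^ 2 ∧
    ∀ δ ∈ S, quadForm P ((𝒜 δ.1).mulVec (samplePoint δ)) ≤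
      γ ^ 2 * quadForm P (samplePoint δ) := by
  unfold JsrFeasible
  rw [frobNorm_le_iff hC]
  constructor
  · rintro ⟨a, b, c, d⟩; exact ⟨a, b, (psd_iff b).1 c, d⟩
  · rintro ⟨a, b, c, d⟩; exact ⟨a, b, (psd_iff b).2 c, d⟩

lemma samplePoint_dot {n m : ℕ} (δ : JsrSample n m) :
    samplePoint δ ⬝ᵥ samplePoint δ = 1 := by
  have h : ‖(δ.2 : EuclideanSpace ℝ (Fin n))‖ = 1 := by simp
  have h2 := EuclideanSpace.norm_sq_eq (δ.2 : EuclideanSpace ℝ (Fin n))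
  rw [h] at h2
  simp only [dotProduct, samplePoint, ← sq]
  simpa using h2.symm

/-- the uncoupled (S-independent) part of feasibility is convex. -/
lemma base_convex {n : ℕ} {P Q : Matrix (Fin n) (Fin n) ℝ} {C t : ℝ}
    (hP : P.IsSymm ∧ (∀ x : Fin n → ℝ, x ⬝ᵥ x ≤ quadForm P x) ∧ frobSq P ≤ C ^ 2)
    (hQ : Q.IsSymm ∧ (∀ x : Fin n → ℝ, x ⬝ᵥ x ≤ quadForm Q x) ∧ frobSq Q ≤ C ^ 2)
    (h0 : 0 ≤ t) (h1 : t ≤ 1) :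
    ((1 - t) • P + t • Q).IsSymm ∧
    (∀ x : Fin n → ℝ, x ⬝ᵥ x ≤ quadForm ((1 - t) • P + t • Q) x) ∧
    frobSq ((1 - t) • P + t • Q) ≤ C ^ 2 := by
  refine ⟨(hP.1.smul _).add (hQ.1.smul _), fun x => ?_, ?_⟩
  · rw [quadForm_comb]
    nlinarith [mul_le_mul_of_nonneg_left (hP.2.1 x) (sub_nonneg.2 h1),
      mul_le_mul_of_nonneg_left (hQ.2.1 x) h0]
  · rw [frobSq_comb]
    nlinarith [mul_le_mul_of_nonneg_left hP.2.2 (sub_nonneg.2 h1),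
      mul_le_mul_of_nonneg_left hQ.2.2 h0,
      mul_nonneg (mul_nonneg h0 (sub_nonneg.2 h1)) (frobSq_nonneg (P - Q))]

lemma cost_lower {n m : ℕ} {𝒜 : Fin m → Matrix (Fin n) (Fin n) ℝ} {C : ℝ}
    {S : Set (JsrSample n m)} {c : ℝ ×ₗ ℝ} (hc : IsLeast (JsrValues 𝒜 C S) c)
    {γ : ℝ} {P : Matrix (Fin n) (Fin n) ℝ} (h : JsrFeasible 𝒜 C S γ P) :
    (ofLex c).1 < γ ∨ (ofLex c).1 = γ ∧ (ofLex c).2 ≤ frobSq P := by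
  have := hc.2 ⟨γ, P, h, rfl⟩
  rw [Prod.Lex.le_iff] at this
  simpa [frobNorm_sq] using this

lemma cost_attained {n m : ℕ} {𝒜 : Fin m → Matrix (Fin n) (Fin n) ℝ} {C : ℝ}
    {S : Set (JsrSample n m)} {c : ℝ ×ₗ ℝ} (hc : IsLeast (JsrValues 𝒜 C S) c) :
    ∃ P, JsrFeasible 𝒜 C S (ofLex c).1 P ∧ (ofLex c).2 = frobSq P := by
  obtain ⟨γ, P, h, e⟩ := hc.1
  refine ⟨P, ?_, ?_⟩ <;> rw [e]
  · exact h
  · simp [frobNorm_sq]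

lemma opt_unique {n m : ℕ} {𝒜 : Fin m → Matrix (Fin n) (Fin n) ℝ} {C : ℝ} (hC : 0 ≤ C)
    {S : Set (JsrSample n m)} {c : ℝ ×ₗ ℝ} (hc : IsLeast (JsrValues 𝒜 C S) c)
    {P Q : Matrix (Fin n) (Fin n) ℝ}
    (hP : JsrFeasible 𝒜 C S (ofLex c).1 P) (hP' : frobSq P ≤ (ofLex c).2)
    (hQ : JsrFeasible 𝒜 C S (ofLex c).1 Q) (hQ' : frobSq Q ≤ (ofLex c).2) : P = Q := by
  rw [feas_iff hC] at hP hQ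
  obtain ⟨g0, p1, p2, p3, p4⟩ := hP
  obtain ⟨-, q1, q2, q3, q4⟩ := hQ
  have hb := base_convex (t := 1 / 2) ⟨p1, p2, p3⟩ ⟨q1, q2, q3⟩ (by norm_num) (by norm_num)
  have hf : JsrFeasible 𝒜 C S (ofLex c).1 ((1 - 1 / 2 : ℝ) • P + (1 / 2 : ℝ) • Q) := by
    rw [feas_iff hC]
    refine ⟨g0, hb.1, hb.2.1, hb.2.2, fun δ hδ => ?_⟩
    rw [quadForm_comb, quadForm_comb]
    nlinarith [p4 δ hδ, q4 δ hδ]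
  rcases cost_lower hc hf with h | ⟨-, h⟩
  · exact absurd h (lt_irrefl _)
  · rw [frobSq_comb] at h
    apply eq_of_frobSq_sub_nonpos
    linarith

lemma active_of_needed {n m : ℕ} {𝒜 : Fin m → Matrix (Fin n) (Fin n) ℝ} {C : ℝ} (hC : 0 ≤ C)
    {S : Set (JsrSample n m)} (hS : S.Finite) {c c' : ℝ ×ₗ ℝ}
    (hc : IsLeast (JsrValues 𝒜 C S) c) {δ₀ : JsrSample n m}
    (hc' : IsLeast (JsrValues 𝒜 C (S \ {δ₀})) c') (hne : c' ≠ c)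
    {P : Matrix (Fin n) (Fin n) ℝ}
    (hP : JsrFeasible 𝒜 C S (ofLex c).1 P) (hP' : frobSq P = (ofLex c).2) (hδ₀ : δ₀ ∈ S) :
    quadForm P ((𝒜 δ₀.1).mulVec (samplePoint δ₀)) =
      (ofLex c).1 ^ 2 * quadForm P (samplePoint δ₀) := by
  set γ := (ofLex c).1 with hγ
  obtain ⟨Q, hQ, hQ'⟩ := cost_attained hc'
  set γ' := (ofLex c').1 with hγ'
  by_contra hact
  have hPS : JsrFeasible 𝒜 C (S \ {δ₀}) γ P := by
    rw [feas_iff hC] at hP ⊢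
    exact ⟨hP.1, hP.2.1, hP.2.2.1, hP.2.2.2.1, fun δ hδ => hP.2.2.2.2 δ hδ.1⟩
  have hlow := cost_lower hc' hPS
  rw [feas_iff hC] at hP hQ
  obtain ⟨g0, p1, p2, p3, p4⟩ := hP
  obtain ⟨g0', q1, q2, q3, q4⟩ := hQ
  have hlt : quadForm P ((𝒜 δ₀.1).mulVec (samplePoint δ₀)) <
      γ ^ 2 * quadForm P (samplePoint δ₀) := lt_of_le_of_ne (p4 _ hδ₀) hact
  -- a small parameter for which the constraint at δ₀ remains strict
  obtain ⟨t, t0, t1, ht⟩ : ∃ t : ℝ, 0 < t ∧ t < 1 ∧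
      quadForm ((1 - t) • P + t • Q) ((𝒜 δ₀.1).mulVec (samplePoint δ₀)) <
        γ ^ 2 * quadForm ((1 - t) • P + t • Q) (samplePoint δ₀) := by
    simp only [quadForm_comb]
    generalize quadForm P ((𝒜 δ₀.1).mulVec (samplePoint δ₀)) = a at *
    generalize quadForm Q ((𝒜 δ₀.1).mulVec (samplePoint δ₀)) = b at *
    generalize quadForm P (samplePoint δ₀) = d at *
    generalize quadForm Q (samplePoint δ₀) = e at *
    have hcont : Continuous fun t : ℝ =>
        γ ^ 2 * ((1 - t) * d + t * e) - ((1 - t) * a + t * b) := by fun_prop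
    have hev := (hcont.tendsto 0).eventually (lt_mem_nhds (a := 0) (by simpa using hlt))
    have h1 : ∀ᶠ t : ℝ in nhds 0, t < 1 := gt_mem_nhds one_pos
    have h2 := (hev.and h1).filter_mono (nhdsWithin_le_nhds (s := Set.Ioi 0))
    obtain ⟨t, ⟨ha, hb⟩, hc⟩ := (h2.and self_mem_nhdsWithin).exists
    exact ⟨t, hc, hb, by linarith⟩
  have hb := base_convex ⟨p1, p2, p3⟩ ⟨q1, q2, q3⟩ t0.le t1.le
  set R := (1 - t) • P + t • Q with hR
  rcases hlow with hl | ⟨he, hv⟩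
  · -- smaller γ
    have hstrict : ∀ δ ∈ S, quadForm R ((𝒜 δ.1).mulVec (samplePoint δ)) <
        γ ^ 2 * quadForm R (samplePoint δ) := by
      intro δ hδ
      by_cases hd : δ = δ₀
      · rw [hd]; exact ht
      · have h1 := p4 δ hδ
        have h2 := q4 δ ⟨hδ, hd⟩
        have h3 := q2 (samplePoint δ)
        rw [samplePoint_dot] at h3
        have h4 : γ' ^ 2 < γ ^ 2 := by gcongr
        have h5 := mul_lt_mul_of_pos_right h4 (lt_of_lt_of_le one_pos h3)
        rw [hR, quadForm_comb, quadForm_comb]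
        nlinarith [mul_le_mul_of_nonneg_left h1 (sub_nonneg.2 t1.le),
          mul_lt_mul_of_pos_left (h2.trans_lt h5) t0]
    have hev : ∀ᶠ g : ℝ in nhds γ, ∀ δ ∈ S, quadForm R ((𝒜 δ.1).mulVec (samplePoint δ)) <
        g ^ 2 * quadForm R (samplePoint δ) := by
      rw [Filter.eventually_all_finite hS]
      intro δ hδ
      have hcont : Continuous fun g : ℝ => g ^ 2 * quadForm R (samplePoint δ) := by fun_prop
      exact (hcont.tendsto γ).eventually (lt_mem_nhds (hstrict δ hδ))
    have h1 : ∀ᶠ g : ℝ in nhds γ, 0 < g := lt_mem_nhds (lt_of_le_of_lt g0' hl)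
    have h2 := (hev.and h1).filter_mono (nhdsWithin_le_nhds (s := Set.Iio γ))
    obtain ⟨g, ⟨ha, hb'⟩, hg⟩ := (h2.and self_mem_nhdsWithin).exists
    have hf : JsrFeasible 𝒜 C S g R := by
      rw [feas_iff hC]
      exact ⟨hb'.le, hb.1, hb.2.1, hb.2.2, fun δ hδ => (ha δ hδ).le⟩
    have hg' : g < γ := hg
    rcases cost_lower hc hf with h | ⟨h, -⟩ <;> linarith
  · have hv' : frobSq Q < frobSq P := by
      rw [← hQ']
      refine lt_of_le_of_ne hv fun h => hne ?_
      apply ofLex.injective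
      exact Prod.ext he (h.trans hP')
    have hf : JsrFeasible 𝒜 C S γ R := by
      rw [feas_iff hC]
      refine ⟨g0, hb.1, hb.2.1, hb.2.2, fun δ hδ => ?_⟩
      by_cases hd : δ = δ₀
      · rw [hd]; exact ht.le
      · have h1 := p4 δ hδ
        have h2 := q4 δ ⟨hδ, hd⟩
        have he' : γ' = γ := he
        rw [he'] at h2
        rw [hR, quadForm_comb, quadForm_comb]
        nlinarith [mul_le_mul_of_nonneg_left h1 (sub_nonneg.2 t1.le),
          mul_le_mul_of_nonneg_left h2 t0.le]
    rcases cost_lower hc hf with h | ⟨-, h⟩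
    · exact absurd h (lt_irrefl _)
    · rw [hR, frobSq_comb, ← hP'] at h
      nlinarith [mul_lt_mul_of_pos_left hv' t0,
        mul_nonneg (mul_nonneg t0.le (sub_nonneg.2 t1.le)) (frobSq_nonneg (P - Q))]

lemma exists_quadForm_ne_zero {n : ℕ} {M : Matrix (Fin n) (Fin n) ℝ} (hM : M.IsSymm)
    (h0 : M ≠ 0) : ∃ v : Fin n → ℝ, quadForm M v ≠ 0 := by
  by_contra! h
  apply h0
  have hd : ∀ i, M i i = 0 := fun i => by
    have := h (Pi.single i 1)
    rw [quadForm_eq_dot] at this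
    simpa using this
  ext i j
  have h1 := h (Pi.single i 1 + Pi.single j 1)
  rw [quadForm_eq_dot] at h1
  simp only [mulVec_add, add_dotProduct, dotProduct_add, mulVec_single_one,
    single_one_dotProduct, Matrix.col_apply, hd] at h1
  have h2 := hM.apply i j
  simp only [Matrix.zero_apply]
  linarith

lemma quadForm_continuous {n : ℕ} :
    Continuous fun p : Matrix (Fin n) (Fin n) ℝ × (Fin n → ℝ) => quadForm p.1 p.2 := by
  unfold quadForm
  refine continuous_finsetSum _ fun i _ => continuous_finsetSum _ fun j _ => ?_
  have : Continuous fun p : Matrix (Fin n) (Fin n) ℝ × (Fin n → ℝ) => p.1 i j :=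
    continuous_fst.matrix_elem i j
  fun_prop

lemma quad_null {n : ℕ} {M : Matrix (Fin n) (Fin n) ℝ} (hM : M.IsSymm) (h0 : M ≠ 0) :
    (volume : Measure (EuclideanSpace ℝ (Fin n))) {x | quadForm M (fun i => x i) = 0} = 0 := by
  obtain ⟨v, hv⟩ := exists_quadForm_ne_zero hM h0
  have hmeas : MeasurableSet {x : EuclideanSpace ℝ (Fin n) | quadForm M (fun i => x i) ≠ 0} := by
    apply IsOpen.measurableSet
    refine isOpen_ne_fun ?_ continuous_const
    exact quadForm_continuous.comp (by fun_prop :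
      Continuous fun x : EuclideanSpace ℝ (Fin n) => (M, fun i => x i))
  have key := ae_mem_of_ae_add_linearMap_mem
    ((LinearMap.id : ℝ →ₗ[ℝ] ℝ).smulRight (WithLp.toLp 2 v : EuclideanSpace ℝ (Fin n)))
    (volume : Measure ℝ) (volume : Measure (EuclideanSpace ℝ (Fin n))) hmeas ?_
  · rw [ae_iff] at key
    simpa using key
  · intro y
    rw [ae_iff]
    have hfin : Set.Finite {t : ℝ | (Polynomial.C (quadForm M v) * Polynomial.X ^ 2 +
        Polynomial.C ((fun i => y i) ⬝ᵥ (M *ᵥ v) + v ⬝ᵥ (M *ᵥ (fun i => y i))) * Polynomial.X +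
        Polynomial.C (quadForm M (fun i => y i))).IsRoot t} := by
      apply Polynomial.finite_setOfPred_isRoot
      intro h
      have := congrArg (fun p => Polynomial.coeff p 2) h
      simp at this
      exact hv this
    refine measure_mono_null ?_ (hfin.measure_zero volume)
    intro t ht
    simp only [Set.mem_ofPred_eq, not_not] at ht
    have e : (fun i => (y + ((LinearMap.id : ℝ →ₗ[ℝ] ℝ).smulRight
        (WithLp.toLp 2 v : EuclideanSpace ℝ (Fin n))) t) i) = (fun i => y i) + t • v := by
      ext i; simp
    rw [e] at ht
    simp only [quadForm_eq_dot, mulVec_add, add_dotProduct, dotProduct_add, mulVec_smul,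
      dotProduct_smul, smul_dotProduct, smul_eq_mul] at ht
    simp only [Set.mem_ofPred_eq, Polynomial.IsRoot, Polynomial.eval_add, Polynomial.eval_mul,
      Polynomial.eval_C, Polynomial.eval_pow, Polynomial.eval_X, quadForm_eq_dot]
    linarith

lemma quad_null_sphere {n : ℕ} {M : Matrix (Fin n) (Fin n) ℝ} (hM : M.IsSymm) (h0 : M ≠ 0) :
    (volume : Measure (EuclideanSpace ℝ (Fin n))).toSphere
      {x | quadForm M (fun i => (x : EuclideanSpace ℝ (Fin n)) i) = 0} = 0 := by
  rw [Measure.toSphere_apply']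
  · rw [measure_mono_null ?_ (quad_null hM h0), mul_zero]
    rintro _ ⟨r, -, _, ⟨x, hx, rfl⟩, rfl⟩
    simp only [Set.mem_ofPred_eq] at hx ⊢
    have e : (fun i => (r • (x : EuclideanSpace ℝ (Fin n))) i) =
        r • (fun i => (x : EuclideanSpace ℝ (Fin n)) i) := by ext i; simp
    simp only [e]
    rw [quadForm_eq_dot] at hx ⊢
    rw [mulVec_smul, dotProduct_smul, smul_dotProduct, hx]; simp
  · apply IsClosed.measurableSet
    refine isClosed_eq ?_ continuous_const
    exact quadForm_continuous.comp (by fun_prop :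
      Continuous fun x : sphere (0 : EuclideanSpace ℝ (Fin n)) 1 =>
        (M, fun i => (x : EuclideanSpace ℝ (Fin n)) i))

lemma point_null_sphere {n : ℕ} (hn : 2 ≤ n) (x : sphere (0 : EuclideanSpace ℝ (Fin n)) 1) :
    (volume : Measure (EuclideanSpace ℝ (Fin n))).toSphere {x} = 0 := by
  rw [Measure.toSphere_apply' _ (measurableSet_singleton x)]
  have hs : Submodule.span ℝ {(x : EuclideanSpace ℝ (Fin n))} ≠ ⊤ := by
    intro h
    have h1 := finrank_span_le_card (R := ℝ) ({(x : EuclideanSpace ℝ (Fin n))} : Set _)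
    rw [h, finrank_top] at h1
    simp at h1
    omega
  rw [measure_mono_null ?_ (Measure.addHaar_submodule volume _ hs), mul_zero]
  rintro _ ⟨r, -, _, ⟨y, hy, rfl⟩, rfl⟩
  rw [Set.mem_singleton_iff] at hy
  subst hy
  exact Submodule.smul_mem _ _ (Submodule.mem_span_singleton_self _)

instance count_scaled_finite (m : ℕ) [NeZero m] :
    IsFiniteMeasure ((m : ℝ≥0∞)⁻¹ • (Measure.count : Measure (Fin m))) :=
  Measure.smul_finite _ (by simp [NeZero.ne m])

instance sphere_scaled_finite (n : ℕ) :
    IsFiniteMeasure (((volume : Measure (EuclideanSpace ℝ (Fin n))).toSphere Set.univ)⁻¹ •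
      (volume : Measure (EuclideanSpace ℝ (Fin n))).toSphere) :=
  ⟨by
    rw [Measure.smul_apply, smul_eq_mul]
    exact lt_of_le_of_lt (ENNReal.inv_mul_le_one _) ENNReal.one_lt_top⟩

instance jsrUniform_finite (n m : ℕ) [NeZero m] : IsFiniteMeasure (jsrUniform n m) := by
  unfold jsrUniform; infer_instance

lemma jsrUniform_null {n m : ℕ} {T : Set (JsrSample n m)} (hT : MeasurableSet T)
    (h : ∀ k, (volume : Measure (EuclideanSpace ℝ (Fin n))).toSphere (Prod.mk k ⁻¹' T) = 0) :
    jsrUniform n m T = 0 := by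
  unfold jsrUniform
  rw [Measure.measure_prod_null hT]
  refine Filter.Eventually.of_forall fun k => ?_
  simp [h k]

lemma pi_null {N : ℕ} {α : Type*} [MeasurableSpace α] (μ : Measure α) [IsFiniteMeasure μ]
    {B : Set (Fin N → α)} (hB : MeasurableSet B) (j : Fin N)
    (h : ∀ ω, μ {x | Function.update ω j x ∈ B} = 0) :
    Measure.pi (fun _ : Fin N => μ) B = 0 := by
  cases N with
  | zero => exact j.elim0
  | succ M =>
    have hmp := measurePreserving_piFinSuccAbove (fun _ : Fin (M + 1) => μ) j
    have hmp' := hmp.symm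
    rw [← hmp'.measure_preimage hB.nullMeasurableSet, Measure.prod_apply_symm]
    · rw [lintegral_eq_zero_of_ae_eq_zero]
      refine Filter.Eventually.of_forall fun y => ?_
      rcases isEmpty_or_nonempty α with hα | ⟨⟨x0⟩⟩
      · exact (congrArg μ (Set.eq_empty_of_isEmpty _)).trans measure_empty
      · have := h (j.insertNth x0 y)
        simp only [Fin.update_insertNth] at this
        exact this
    · exact hmp'.measurable hB

lemma isClosed_proj {Z Y : Type*} [TopologicalSpace Z] [TopologicalSpace Y] {K : Set Y}
    (hK : IsCompact K) {F : Set (Z × Y)} (hF : IsClosed F) :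
    IsClosed {z | ∃ y ∈ K, (z, y) ∈ F} := by
  have := isCompact_iff_compactSpace.1 hK
  have h1 : IsClosed ((fun p : Z × K => (p.1, (p.2 : Y))) ⁻¹' F) :=
    hF.preimage (by fun_prop)
  convert isClosedMap_fst_of_compactSpace _ h1 using 1
  ext z
  simp

lemma point_continuous {n m : ℕ} : Continuous (samplePoint : JsrSample n m → Fin n → ℝ) := by
  unfold samplePoint
  fun_prop

lemma image_point_continuous {n m : ℕ} (𝒜 : Fin m → Matrix (Fin n) (Fin n) ℝ) :
    Continuous fun δ : JsrSample n m => (𝒜 δ.1).mulVec (samplePoint δ) :=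
  Continuous.matrix_mulVec ((continuous_of_discreteTopology (f := 𝒜)).comp continuous_fst)
    point_continuous

lemma frobSq_continuous {n : ℕ} :
    Continuous (frobSq : Matrix (Fin n) (Fin n) ℝ → ℝ) := by
  unfold frobSq
  refine continuous_finsetSum _ fun i _ => continuous_finsetSum _ fun j _ => ?_
  exact (continuous_id.matrix_elem i j).pow 2

/-- Box containing all matrices of squared Frobenius norm at most `C ^ 2`. -/
def box (n : ℕ) (C : ℝ) : Set (Matrix (Fin n) (Fin n) ℝ) :=
  Set.univ.pi fun _ => Set.univ.pi fun _ => Set.Icc (-C) C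

lemma box_compact (n : ℕ) (C : ℝ) : IsCompact (box n C) :=
  isCompact_univ_pi fun _ => isCompact_univ_pi fun _ => isCompact_Icc

lemma mem_box {n : ℕ} {C : ℝ} (hC : 0 ≤ C) {P : Matrix (Fin n) (Fin n) ℝ}
    (h : frobSq P ≤ C ^ 2) : P ∈ box n C := by
  intro i _ j _
  refine abs_le.1 (?_ : |P i j| ≤ C)
  apply abs_le_of_sq_le_sq _ hC
  refine le_trans ?_ h
  unfold frobSq
  refine le_trans ?_ (Finset.single_le_sum (f := fun i => ∑ j, P i j ^ 2)
    (fun i _ => by positivity) (Finset.mem_univ i))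
  exact Finset.single_le_sum (f := fun j => P i j ^ 2) (fun i _ => by positivity)
    (Finset.mem_univ j)

lemma feas_closed {n m N : ℕ} (𝒜 : Fin m → Matrix (Fin n) (Fin n) ℝ) {C : ℝ} (hC : 0 ≤ C)
    (I : Set (Fin N)) :
    IsClosed {p : ((Fin N → JsrSample n m) × ℝ × ℝ) × Matrix (Fin n) (Fin n) ℝ |
      JsrFeasible 𝒜 C (p.1.1 '' I) p.1.2.1 p.2 ∧ frobSq p.2 ≤ p.1.2.2} := by
  simp only [feas_iff hC, Set.forall_mem_image]
  have hx : ∀ i, Continuous fun p : ((Fin N → JsrSample n m) × ℝ × ℝ) ×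
      Matrix (Fin n) (Fin n) ℝ => p.1.1 i := fun i => by fun_prop
  have hq : ∀ f : (((Fin N → JsrSample n m) × ℝ × ℝ) × Matrix (Fin n) (Fin n) ℝ) → (Fin n → ℝ),
      Continuous f → Continuous fun p => quadForm p.2 (f p) := fun f hf =>
    quadForm_continuous.comp (continuous_snd.prodMk hf)
  refine IsClosed.and (IsClosed.and ?_ (IsClosed.and ?_ (IsClosed.and ?_ (IsClosed.and ?_ ?_)))) ?_
  · exact isClosed_le continuous_const (by fun_prop)
  · exact isClosed_eq (continuous_snd.matrix_transpose) continuous_snd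
  · simp only [Set.ofPred_forall]
    exact isClosed_iInter fun x => isClosed_le continuous_const (hq _ continuous_const)
  · exact isClosed_le (frobSq_continuous.comp continuous_snd) continuous_const
  · simp only [Set.ofPred_forall]
    refine isClosed_iInter fun i => isClosed_iInter fun _ => isClosed_le ?_ ?_
    · exact hq _ ((image_point_continuous 𝒜).comp (hx i))
    · exact Continuous.mul (by fun_prop) (hq _ (point_continuous.comp (hx i)))
  · exact isClosed_le (frobSq_continuous.comp continuous_snd) (by fun_prop)

lemma active_closed {n m N : ℕ} (𝒜 : Fin m → Matrix (Fin n) (Fin n) ℝ) (j : Fin N) :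
    IsClosed {p : ((Fin N → JsrSample n m) × ℝ × ℝ) × Matrix (Fin n) (Fin n) ℝ |
      quadForm p.2 ((𝒜 (p.1.1 j).1).mulVec (samplePoint (p.1.1 j))) =
        p.1.2.1 ^ 2 * quadForm p.2 (samplePoint (p.1.1 j))} := by
  have hx : Continuous fun p : ((Fin N → JsrSample n m) × ℝ × ℝ) ×
      Matrix (Fin n) (Fin n) ℝ => p.1.1 j := by fun_prop
  have hq : ∀ f : (((Fin N → JsrSample n m) × ℝ × ℝ) × Matrix (Fin n) (Fin n) ℝ) → (Fin n → ℝ),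
      Continuous f → Continuous fun p => quadForm p.2 (f p) := fun f hf =>
    quadForm_continuous.comp (continuous_snd.prodMk hf)
  refine isClosed_eq ?_ ?_
  · exact hq _ ((image_point_continuous 𝒜).comp hx)
  · exact Continuous.mul (by fun_prop) (hq _ (point_continuous.comp hx))

lemma proj_closed {n m N : ℕ} (𝒜 : Fin m → Matrix (Fin n) (Fin n) ℝ) {C : ℝ} (hC : 0 ≤ C)
    (I : Set (Fin N)) :
    IsClosed {z : (Fin N → JsrSample n m) × ℝ × ℝ |
      ∃ P, JsrFeasible 𝒜 C (z.1 '' I) z.2.1 P ∧ frobSq P ≤ z.2.2} := by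
  convert isClosed_proj (box_compact n C) (feas_closed 𝒜 hC I) using 1
  ext z
  constructor
  · rintro ⟨P, h⟩
    exact ⟨P, mem_box hC ((feas_iff hC).1 h.1).2.2.2.1, h⟩
  · rintro ⟨P, -, h⟩; exact ⟨P, h⟩

lemma proj_active_closed {n m N : ℕ} (𝒜 : Fin m → Matrix (Fin n) (Fin n) ℝ) {C : ℝ}
    (hC : 0 ≤ C) (I : Set (Fin N)) (j : Fin N) :
    IsClosed {z : (Fin N → JsrSample n m) × ℝ × ℝ |
      ∃ P, (JsrFeasible 𝒜 C (z.1 '' I) z.2.1 P ∧ frobSq P ≤ z.2.2) ∧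
        quadForm P ((𝒜 (z.1 j).1).mulVec (samplePoint (z.1 j))) =
        z.2.1 ^ 2 * quadForm P (samplePoint (z.1 j))} := by
  convert isClosed_proj (box_compact n C) ((feas_closed 𝒜 hC I).inter (active_closed 𝒜 j)) using 1
  ext z
  constructor
  · rintro ⟨P, h⟩
    exact ⟨P, mem_box hC ((feas_iff hC).1 h.1.1).2.2.2.1, h⟩
  · rintro ⟨P, -, h⟩; exact ⟨P, h⟩

section Main

variable {n m N : ℕ} {𝒜 : Fin m → Matrix (Fin n) (Fin n) ℝ} {C : ℝ}
    {Cost : Set (JsrSample n m) → ℝ ×ₗ ℝ}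

lemma gamma_measurable (hC : 0 ≤ C)
    (hCost : ∀ S : Set (JsrSample n m), S.Finite → IsLeast (JsrValues 𝒜 C S) (Cost S))
    (I : Set (Fin N)) :
    Measurable fun ω : Fin N → JsrSample n m => (ofLex (Cost (ω '' I))).1 := by
  refine measurable_of_Iic fun a => ?_
  have h := (proj_closed 𝒜 hC I).measurableSet.preimage
    (by fun_prop : Measurable fun ω : Fin N → JsrSample n m => (ω, a, C ^ 2))
  convert h using 1
  ext ω
  have hc := hCost (ω '' I) (I.toFinite.image _)
  simp only [Set.mem_preimage, Set.mem_Iic, Set.mem_ofPred_eq]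
  constructor
  · intro hle
    obtain ⟨P, hP, -⟩ := cost_attained hc
    rw [feas_iff hC] at hP
    refine ⟨P, ?_, hP.2.2.2.1⟩
    rw [feas_iff hC]
    refine ⟨hP.1.trans hle, hP.2.1, hP.2.2.1, hP.2.2.2.1, fun δ hδ => ?_⟩
    refine (hP.2.2.2.2 δ hδ).trans ?_
    have h1 := hP.2.2.1 (samplePoint δ)
    rw [samplePoint_dot] at h1
    have := hP.1
    gcongr
  · rintro ⟨P, hP, -⟩
    rcases cost_lower hc hP with h | ⟨h, -⟩ <;> linarith

lemma value_measurable (hC : 0 ≤ C)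
    (hCost : ∀ S : Set (JsrSample n m), S.Finite → IsLeast (JsrValues 𝒜 C S) (Cost S))
    (I : Set (Fin N)) :
    Measurable fun ω : Fin N → JsrSample n m => (ofLex (Cost (ω '' I))).2 := by
  refine measurable_of_Iic fun a => ?_
  have hg := gamma_measurable hC hCost I
  have h := (proj_closed 𝒜 hC I).measurableSet.preimage
    (by fun_prop : Measurable fun ω : Fin N → JsrSample n m =>
      (ω, (ofLex (Cost (ω '' I))).1, a))
  convert h using 1
  ext ω
  have hc := hCost (ω '' I) (I.toFinite.image _)
  simp only [Set.mem_preimage, Set.mem_Iic, Set.mem_ofPred_eq]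
  constructor
  · intro hle
    obtain ⟨P, hP, hP'⟩ := cost_attained hc
    exact ⟨P, hP, hP' ▸ hle⟩
  · rintro ⟨P, hP, hPv⟩
    rcases cost_lower hc hP with h | ⟨-, h⟩
    · exact absurd h (lt_irrefl _)
    · exact le_trans h hPv

/-- Bad event: the constraint `j` is active at the optimum of the problem sampled at `I`. -/
def badSet (𝒜 : Fin m → Matrix (Fin n) (Fin n) ℝ) (C : ℝ)
    (Cost : Set (JsrSample n m) → ℝ ×ₗ ℝ) (I : Set (Fin N)) (j : Fin N) :
    Set (Fin N → JsrSample n m) :=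
  {ω | ∃ P, (JsrFeasible 𝒜 C (ω '' I) (ofLex (Cost (ω '' I))).1 P ∧
      frobSq P ≤ (ofLex (Cost (ω '' I))).2) ∧
        quadForm P ((𝒜 (ω j).1).mulVec (samplePoint (ω j))) =
        (ofLex (Cost (ω '' I))).1 ^ 2 * quadForm P (samplePoint (ω j))}

lemma badSet_measurable (hC : 0 ≤ C)
    (hCost : ∀ S : Set (JsrSample n m), S.Finite → IsLeast (JsrValues 𝒜 C S) (Cost S))
    (I : Set (Fin N)) (j : Fin N) : MeasurableSet (badSet 𝒜 C Cost I j) := by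
  have hg := gamma_measurable hC hCost I
  have hv := value_measurable hC hCost I
  exact (proj_active_closed 𝒜 hC I j).measurableSet.preimage
    (by fun_prop : Measurable fun ω : Fin N → JsrSample n m =>
      (ω, (ofLex (Cost (ω '' I))).1, (ofLex (Cost (ω '' I))).2))

lemma quadForm_pullback (A P : Matrix (Fin n) (Fin n) ℝ) (g : ℝ) (x : Fin n → ℝ) :
    quadForm (Aᵀ * P * A - g • P) x = quadForm P (A *ᵥ x) - g * quadForm P x := by
  simp only [quadForm_eq_dot, sub_mulVec, smul_mulVec, dotProduct_sub, dotProduct_smul,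
    smul_eq_mul, ← mulVec_mulVec]
  congr 1
  rw [dotProduct_mulVec, vecMul_transpose]

lemma badSet_null [NeZero m] (hC : 0 ≤ C)
    (hBar : ∀ k : Fin m, ¬ IsBarabanov (𝒜 k))
    (hCost : ∀ S : Set (JsrSample n m), S.Finite → IsLeast (JsrValues 𝒜 C S) (Cost S))
    (I : Set (Fin N)) (j : Fin N) (hj : j ∉ I) :
    Measure.pi (fun _ : Fin N => jsrUniform n m) (badSet 𝒜 C Cost I j) = 0 := by
  refine pi_null _ (badSet_measurable hC hCost I j) j fun ω => ?_
  have himg : ∀ x, Function.update ω j x '' I = ω '' I := fun x => by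
    refine Set.image_congr fun i hi => ?_
    rw [Function.update_of_ne]
    rintro rfl
    exact hj hi
  have hc := hCost (ω '' I) (I.toFinite.image _)
  obtain ⟨P, hP, hP'⟩ := cost_attained hc
  set γ := (ofLex (Cost (ω '' I))).1 with hγ
  have hcl : IsClosed {δ : JsrSample n m | quadForm P ((𝒜 δ.1).mulVec (samplePoint δ)) =
      γ ^ 2 * quadForm P (samplePoint δ)} := by
    have hq : ∀ f : JsrSample n m → (Fin n → ℝ), Continuous f →
        Continuous fun p => quadForm P (f p) := fun f hf =>
      quadForm_continuous.comp (continuous_const.prodMk hf)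
    exact isClosed_eq (hq _ (image_point_continuous 𝒜))
      (continuous_const.mul (hq _ point_continuous))
  refine measure_mono_null (t := {δ : JsrSample n m |
    quadForm P ((𝒜 δ.1).mulVec (samplePoint δ)) = γ ^ 2 * quadForm P (samplePoint δ)}) ?_ ?_
  · rintro x ⟨Q, ⟨hQ, hQ'⟩, ha⟩
    rw [himg] at hQ hQ' ha
    have := opt_unique hC hc hP hP'.ge hQ hQ'
    subst this
    simpa using ha
  · refine jsrUniform_null hcl.measurableSet fun k => ?_
    have hP2 := (feas_iff hC).1 hP
    have hM : ((𝒜 k)ᵀ * P * 𝒜 k - γ ^ 2 • P).IsSymm := by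
      refine Matrix.IsSymm.sub ?_ (hP2.2.1.smul _)
      rw [Matrix.IsSymm, transpose_mul, transpose_mul, transpose_transpose, hP2.2.1.eq,
        Matrix.mul_assoc]
    have hM0 : (𝒜 k)ᵀ * P * 𝒜 k - γ ^ 2 • P ≠ 0 := by
      intro h0
      refine hBar k ⟨P, hP2.2.1, ?_, γ, hP2.1, sub_eq_zero.1 h0⟩
      refine Matrix.PosDef.of_dotProduct_mulVec_pos ?_ fun x hx => ?_
      · rw [Matrix.IsHermitian, Matrix.conjTranspose_eq_transpose_of_trivial]; exact hP2.2.1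
      · rw [star_trivial, ← quadForm_eq_dot]
        refine lt_of_lt_of_le ?_ (hP2.2.2.1 x)
        have := dotProduct_star_self_pos_iff.2 hx
        simpa using this
    convert quad_null_sphere hM hM0 using 2
    ext x
    simp only [Set.mem_preimage, Set.mem_ofPred_eq, quadForm_pullback, sub_eq_zero]
    rfl

lemma diag_null [NeZero m] (hn : 2 ≤ n) (i j : Fin N) (hij : i ≠ j) :
    Measure.pi (fun _ : Fin N => jsrUniform n m) {ω | ω i = ω j} = 0 := by
  refine pi_null _ (IsClosed.measurableSet
    (isClosed_eq (continuous_apply i) (continuous_apply j))) j fun ω => ?_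
  simp only [Set.mem_ofPred_eq, Function.update_self, Function.update_of_ne hij]
  have : {x | ω i = x} = {ω i} := by ext x; simp [eq_comm]
  rw [this]
  refine jsrUniform_null (measurableSet_singleton _) fun k => ?_
  refine measure_mono_null ?_ (point_null_sphere hn (ω i).2)
  intro x hx
  have : (k, x) = ω i := hx
  simp [← this]

end Main

lemma two_le_of_not_barabanov {n : ℕ} (hn : 1 ≤ n) {A : Matrix (Fin n) (Fin n) ℝ}
    (h : ¬ IsBarabanov A) : 2 ≤ n := by
  by_contra hlt
  obtain rfl : n = 1 := by omega
  refine h ⟨1, Matrix.isSymm_one, Matrix.PosDef.one, |A 0 0|, abs_nonneg _, ?_⟩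
  ext i j
  fin_cases i; fin_cases j
  simp [Matrix.mul_apply, sq]

/-- If no matrix in `𝒜` is Barabanov, then for every `N ∈ ℕ_*` the sample
vector `ω̄_N` is non-degenerate (there is a unique index set `I` such that
`{δ_i}_{i ∈ I}` is an essential set for `P_jsr(ω_N)`) with probability one. -/
theorem jsr_samples_nondegenerate_almost_surely
    {n m : ℕ} (hn : 1 ≤ n) (hm : 1 ≤ m)
    (𝒜 : Fin m → Matrix (Fin n) (Fin n) ℝ)
    (hBar : ∀ k : Fin m, ¬ IsBarabanov (𝒜 k))
    (C : ℝ) (hC : (n : ℝ) ≤ C)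
    -- `Cost S` is the optimal value of the sampled problem `P_jsr(S)`
    (Cost : Set (JsrSample n m) → ℝ ×ₗ ℝ)
    (hCost : ∀ S : Set (JsrSample n m), S.Finite →
      IsLeast (JsrValues 𝒜 C S) (Cost S))
    (N : ℕ) (hN : 0 < N) :
    ∀ᵐ ωbar ∂(Measure.pi fun _ : Fin N => jsrUniform n m),
      ∃! I : Set (Fin N), IsEssentialSet Cost (Set.range ωbar) (ωbar '' I) := by
  have : NeZero m := ⟨by omega⟩
  have hn2 : 2 ≤ n := two_le_of_not_barabanov hn (hBar ⟨0, hm⟩)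
  have hC0 : 0 ≤ C := le_trans (Nat.cast_nonneg n) hC
  have hbad : ∀ᵐ ω ∂(Measure.pi fun _ : Fin N => jsrUniform n m),
      ∀ (I : Set (Fin N)) (j : Fin N), j ∉ I → ω ∉ badSet 𝒜 C Cost I j := by
    rw [ae_all_iff]; intro I
    rw [ae_all_iff]; intro j
    by_cases hj : j ∈ I
    · simp [hj]
    · filter_upwards [measure_eq_zero_iff_ae_notMem.1 (badSet_null hC0 hBar hCost I j hj)]
        with ω hω _ using hω
  have hdiag : ∀ᵐ ω ∂(Measure.pi fun _ : Fin N => jsrUniform n m),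
      ∀ (i j : Fin N), i ≠ j → ω i ≠ ω j := by
    rw [ae_all_iff]; intro i
    rw [ae_all_iff]; intro j
    by_cases hij : i = j
    · simp [hij]
    · filter_upwards [measure_eq_zero_iff_ae_notMem.1 (diag_null (m := m) hn2 i j hij)]
        with ω hω _ using hω
  filter_upwards [hbad, hdiag] with ω hω hinj'
  have hinj : Function.Injective ω := fun i j h => by
    by_contra hne
    exact hinj' i j hne h
  have hfin : (Set.range ω).Finite := Set.finite_range ω
  -- key step: two essential sets are nested
  have key : ∀ I J : Set (Fin N), IsEssentialSet Cost (Set.range ω) (ω '' I) →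
      IsEssentialSet Cost (Set.range ω) (ω '' J) → J ⊆ I := by
    intro I J hI hJ j hj
    by_contra hjI
    have hcR := hCost _ hfin
    obtain ⟨P, hP, hP'⟩ := cost_attained hcR
    have hsub : ∀ T ⊆ Set.range ω, JsrFeasible 𝒜 C T (ofLex (Cost (Set.range ω))).1 P := by
      intro T hT
      exact ⟨hP.1, hP.2.1, hP.2.2.1, hP.2.2.2.1, fun δ hδ => hP.2.2.2.2 δ (hT hδ)⟩
    have hcJ := hCost _ hJ.2.1
    have hcJ' := hCost _ (hJ.2.1.sdiff (t := {ω j}))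
    have hmem : ω j ∈ ω '' J := Set.mem_image_of_mem _ hj
    have hne : Cost (ω '' J \ {ω j}) ≠ Cost (ω '' J) := by
      intro he
      have h1 := hJ.2.2.2 _ (Set.sdiff_subset.trans hJ.1) hJ.2.1.sdiff (he.trans hJ.2.2.1)
      have h2 := Set.ncard_sdiff_singleton_lt_of_mem hmem hJ.2.1
      omega
    have hPJ : JsrFeasible 𝒜 C (ω '' J) (ofLex (Cost (ω '' J))).1 P := by
      rw [hJ.2.2.1]; exact hsub _ hJ.1
    have hact := active_of_needed hC0 hJ.2.1 hcJ hcJ' hne hPJ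
      (by rw [hJ.2.2.1]; exact hP'.symm) hmem
    refine hω I j hjI ⟨P, ⟨?_, ?_⟩, ?_⟩
    · rw [hI.2.2.1]; exact hsub _ hI.1
    · rw [hI.2.2.1]; exact hP'.ge
    · rw [hI.2.2.1]; rw [hJ.2.2.1] at hact; exact hact
  -- existence of an essential set
  have hex : ∃ k : ℕ, ∃ β : Set (JsrSample n m), β ⊆ Set.range ω ∧
      Cost β = Cost (Set.range ω) ∧ β.ncard = k :=
    ⟨_, Set.range ω, subset_rfl, rfl, rfl⟩
  classical
  obtain ⟨β, hβ, hβc, hβk⟩ := Nat.find_spec hex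
  have hess : IsEssentialSet Cost (Set.range ω) (ω '' (ω ⁻¹' β)) := by
    rw [Set.image_preimage_eq_of_subset hβ]
    refine ⟨hβ, hfin.subset hβ, hβc, fun β' h1 _ h3 => ?_⟩
    rw [hβk]
    exact Nat.find_min' hex ⟨β', h1, h3, rfl⟩
  exact ⟨ω ⁻¹' β, hess, fun J hJ =>
    Set.Subset.antisymm (key _ _ hess hJ) (key _ _ hJ hess)⟩
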